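/- arXiv:1805.02698 — 2 statements merged into one kernel-verified Lean document; each statement's English description precedes it below -/
import Mathlib

section
/- Fix a > 0 and define M(C) = Q(C) − 2a + a²·P(C) for C > 0. Then M is differentiable on (0, ∞) with M′(C) = e^{F(C)}·(1 − a²/C²); consequently M is strictly decreasing on (0, a) and strictly increasing on (a, ∞), so that C = a is the unique minimum point of M on (0, ∞), and if M(a) = 0 then M(C) > 0 for every C ∈ (0, ∞) with C ≠ a. -/
open MeasureTheory Real Set Filter

theorem hasDerivAt_integral_Ioi {f : ℝ → ℝ} (hf : ContinuousOn f (Ioi 0))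
    (hfi : ∀ C, 0 < C → IntegrableOn f (Ioi C)) {c : ℝ} (hc : 0 < c) :
    HasDerivAt (fun x => ∫ s in Ioi x, f s) (-f c) c := by
  have hc2 : 0 < c / 2 := by positivity
  have hii : ∀ x, c / 2 < x → IntervalIntegrable f volume (c / 2) x := fun x hx =>
    (intervalIntegrable_iff_integrableOn_Ioc_of_le hx.le).2
      ((hfi _ hc2).mono_set Ioc_subset_Ioi_self)
  have hd : HasDerivAt (fun x => (∫ s in Ioi (c / 2), f s) - ∫ s in (c / 2)..x, f s)
      (-f c) c :=
    (intervalIntegral.integral_hasDerivAt_right (hii c (by linarith))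
      (hf.stronglyMeasurableAtFilter isOpen_Ioi c hc)
      (hf.continuousAt (Ioi_mem_nhds hc))).const_sub _
  refine hd.congr_of_eventuallyEq ?_
  filter_upwards [Ioi_mem_nhds (show c / 2 < c by linarith)] with x hx
  have := intervalIntegral.integral_interval_add_Ioi (hfi _ hc2) (hfi x (hc2.trans hx))
  linarith

theorem integrableOn_one_sub_exp_neg_tail
    {α : ℝ} (hα : 0 < α) {u : ℝ → ℝ} {K C₀ : ℝ} (hC₀ : 0 < C₀)
    (hbound : ∀ C, C₀ ≤ C → |u C| ≤ K * C ^ (-(3/2 : ℝ) - α))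
    (hint : ∀ C, 0 < C → IntegrableOn (fun s => (u s) ^ 2 * s) (Ioi C))
    {F : ℝ → ℝ} (hF : ∀ C, F C = -∫ s in Ioi C, (u s) ^ 2 * s)
    (hFc : ContinuousOn F (Ioi 0)) {C : ℝ} (hC : 0 < C) :
    IntegrableOn (fun s => 1 - exp (F s)) (Ioi C) := by
  have hcont : ContinuousOn (fun s => 1 - exp (F s)) (Ici C) :=
    (continuousOn_const.sub hFc.rexp).mono (fun x hx => hC.trans_le hx)
  refine ((hcont.locallyIntegrableOn measurableSet_Ici).integrableOn_of_isBigO_atTop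
    (g := fun s : ℝ => s ^ (-1 - 2 * α)) ?_ ?_).mono_set Ioi_subset_Ici_self
  · refine Asymptotics.IsBigO.of_bound (K ^ 2 / (1 + 2 * α)) ?_
    filter_upwards [eventually_ge_atTop C₀] with s hs
    have hs0 : 0 < s := hC₀.trans_le hs
    have hlt : -2 - 2 * α < -1 := by linarith
    have hpt : ∀ t ∈ Ioi s, (u t) ^ 2 * t ≤ K ^ 2 * t ^ (-2 - 2 * α) := by
      intro t ht
      have ht0 : 0 < t := hs0.trans ht
      have hsq : (u t) ^ 2 ≤ (K * t ^ (-(3/2 : ℝ) - α)) ^ 2 := by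
        rw [← sq_abs]
        exact pow_le_pow_left₀ (abs_nonneg _) (hbound t (hs.trans (le_of_lt ht))) 2
      calc (u t) ^ 2 * t ≤ (K * t ^ (-(3/2 : ℝ) - α)) ^ 2 * t := by gcongr
        _ = K ^ 2 * ((t ^ (-(3/2 : ℝ) - α) * t ^ (-(3/2 : ℝ) - α)) * t ^ (1 : ℝ)) := by
          rw [rpow_one]; ring
        _ = K ^ 2 * t ^ (-2 - 2 * α) := by
          rw [← rpow_add ht0, ← rpow_add ht0]; ring_nf
    have hle : ∫ t in Ioi s, (u t) ^ 2 * t ≤ ∫ t in Ioi s, K ^ 2 * t ^ (-2 - 2 * α) :=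
      setIntegral_mono_on (hint s hs0)
        ((integrableOn_Ioi_rpow_of_lt hlt hs0).const_mul _) measurableSet_Ioi hpt
    have hnn : 0 ≤ ∫ t in Ioi s, (u t) ^ 2 * t :=
      setIntegral_nonneg measurableSet_Ioi fun t ht =>
        mul_nonneg (sq_nonneg _) (hs0.trans ht).le
    rw [integral_const_mul, integral_Ioi_rpow_of_lt hlt hs0] at hle
    have hrw : K ^ 2 * (-s ^ (-2 - 2 * α + 1) / (-2 - 2 * α + 1))
        = K ^ 2 / (1 + 2 * α) * s ^ (-1 - 2 * α) := by
      rw [show -2 - 2 * α + 1 = -1 - 2 * α by ring,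
        show -1 - 2 * α = -(1 + 2 * α) by ring, neg_div_neg_eq]
      ring
    have h1 := add_one_le_exp (F s)
    have h2 : exp (F s) ≤ 1 := exp_le_one_iff.2 (by rw [hF]; linarith)
    rw [norm_of_nonneg (by linarith), norm_of_nonneg (rpow_nonneg hs0.le _), ← hrw]
    linarith [hF s]
  · exact ⟨Ioi 1, Ioi_mem_atTop 1, integrableOn_Ioi_rpow_of_lt (by linarith) one_pos⟩

theorem stmt_13
    (α : ℝ) (hα : 0 < α)
    (u : ℝ → ℝ) (hu : ContinuousOn u (Set.Ioi 0))
    (K C₀ : ℝ) (hK : 0 < K) (hC₀ : 0 < C₀)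
    (hbound : ∀ C, C₀ ≤ C → |u C| ≤ K * C ^ (-(3/2 : ℝ) - α))
    (hint : ∀ C, 0 < C → MeasureTheory.IntegrableOn (fun s => (u s) ^ 2 * s) (Set.Ioi C))
    (F Q P : ℝ → ℝ)
    (hF : ∀ C, F C = -∫ s in Set.Ioi C, (u s) ^ 2 * s)
    (hQ : ∀ C, Q C = C + ∫ s in Set.Ioi C, (1 - Real.exp (F s)))
    (hP : ∀ C, P C = ∫ s in Set.Ioi C, Real.exp (F s) / s ^ 2)
    (a : ℝ) (ha : 0 < a)
    (M : ℝ → ℝ) (hM : ∀ C, M C = Q C - 2 * a + a ^ 2 * P C) :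
    (∀ C, 0 < C → HasDerivAt M (Real.exp (F C) * (1 - a ^ 2 / C ^ 2)) C) ∧
      StrictAntiOn M (Set.Ioo 0 a) ∧ StrictMonoOn M (Set.Ioi a) ∧
      (∀ C, 0 < C → C ≠ a → M a < M C) ∧
      (M a = 0 → ∀ C, 0 < C → C ≠ a → 0 < M C) := by
  have hFc : ContinuousOn F (Ioi 0) := by
    rw [funext hF]
    exact fun x hx => (hasDerivAt_integral_Ioi ((hu.pow 2).mul continuousOn_id) hint
      hx).neg.continuousAt.continuousWithinAt
  have hF0 : ∀ s, 0 < s → F s ≤ 0 := fun s hs => by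
    rw [hF, neg_nonpos]
    exact setIntegral_nonneg measurableSet_Ioi fun t ht =>
      mul_nonneg (sq_nonneg _) (hs.trans ht).le
  have hPc : ContinuousOn (fun s => exp (F s) / s ^ 2) (Ioi 0) :=
    hFc.rexp.div (continuousOn_id.pow 2) fun s hs => pow_ne_zero 2 (ne_of_gt hs)
  have hPi : ∀ C, 0 < C → IntegrableOn (fun s => exp (F s) / s ^ 2) (Ioi C) := by
    intro C hC
    refine Integrable.mono' (integrableOn_Ioi_rpow_of_lt (a := -2) (by norm_num) hC)
      ((hPc.mono (Ioi_subset_Ioi hC.le)).aestronglyMeasurable measurableSet_Ioi) ?_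
    filter_upwards [ae_restrict_mem measurableSet_Ioi] with s hs
    have hs0 : 0 < s := hC.trans hs
    rw [norm_of_nonneg (by positivity), rpow_neg hs0.le, rpow_two, ← one_div]
    gcongr
    exact exp_le_one_iff.2 (hF0 s hs0)
  have hd : ∀ C, 0 < C → HasDerivAt M (exp (F C) * (1 - a ^ 2 / C ^ 2)) C := by
    intro C hC
    rw [funext hM, funext hQ, funext hP]
    have hQd : HasDerivAt (fun x => ∫ s in Ioi x, (1 - exp (F s))) (-(1 - exp (F C))) C :=
      hasDerivAt_integral_Ioi (continuousOn_const.sub hFc.rexp)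
        (fun x hx => integrableOn_one_sub_exp_neg_tail hα hC₀ hbound hint hF hFc hx) hC
    have hPd := (hasDerivAt_integral_Ioi hPc hPi hC).const_mul (a ^ 2)
    refine ((((hasDerivAt_id' C).fun_add hQd).sub_const (2 * a)).fun_add hPd).congr_deriv ?_
    ring
  have hanti : StrictAntiOn M (Ioc 0 a) := by
    refine strictAntiOn_of_deriv_neg (convex_Ioc 0 a)
      (fun x hx => (hd x hx.1).continuousAt.continuousWithinAt) fun x hx => ?_
    rw [interior_Ioc] at hx
    rw [(hd x hx.1).deriv]
    have hx0 := hx.1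
    have : 1 < a ^ 2 / x ^ 2 := by
      rw [one_lt_div (by positivity)]
      exact pow_lt_pow_left₀ hx.2 hx0.le two_ne_zero
    exact mul_neg_of_pos_of_neg (exp_pos _) (by linarith)
  have hmono : StrictMonoOn M (Ici a) := by
    refine strictMonoOn_of_deriv_pos (convex_Ici a)
      (fun x hx => (hd x (ha.trans_le hx)).continuousAt.continuousWithinAt) fun x hx => ?_
    rw [interior_Ici] at hx
    have hx0 : 0 < x := ha.trans hx
    rw [(hd x hx0).deriv]
    have : a ^ 2 / x ^ 2 < 1 := by
      rw [div_lt_one (by positivity)]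
      exact pow_lt_pow_left₀ hx ha.le two_ne_zero
    exact mul_pos (exp_pos _) (by linarith)
  have hmin : ∀ C, 0 < C → C ≠ a → M a < M C := by
    intro C hC hne
    rcases lt_or_gt_of_ne hne with h | h
    · exact hanti ⟨hC, h.le⟩ ⟨ha, le_rfl⟩ h
    · exact hmono self_mem_Ici (le_of_lt h) h
  exact ⟨hd, hanti.mono Ioo_subset_Ioc_self, hmono.mono Ioi_subset_Ici_self, hmin,
    fun h0 C hC hne => h0 ▸ hmin C hC hne⟩
end

section
/- Let C* = 1 and define A = ∫_1^∞ Q(s)·h(s)/s⁴ ds, B = ∫_1^∞ h(s)/s⁴ ds, D = ∫_1^∞ P(s)·h(s)/s⁴ ds, X = P(1)·B − D, m = (P(1)·A − Q(1)·D)/(3X), and q = √((A − Q(1)·B)/(2X)). Then q/m = 3·a^{5/2}·√((a⁵ + 3a³ − 2a² − 3a + 2)·(2a⁴ + 4a³ − 4a² − 4a + 3)) / (4a⁷ + 6a⁶ − 2a⁵ − 4a⁴ − 5a³ + 2a² + 3a − 1). -/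
open MeasureTheory Real Set Filter

lemma setIntegral_Ioi_eq_add_of_piecewise {f g₁ g₂ : ℝ → ℝ} {c a : ℝ} (hca : c ≤ a)
    (hf₁ : ∀ s, c < s → s < a → f s = g₁ s) (hf₂ : ∀ s, a ≤ s → f s = g₂ s)
    (hg₁ : IntegrableOn g₁ (Set.Ioo c a)) (hg₂ : IntegrableOn g₂ (Set.Ioi a)) :
    ∫ s in Set.Ioi c, f s = (∫ s in Set.Ioo c a, g₁ s) + ∫ s in Set.Ioi a, g₂ s := by
  have e₁ : Set.EqOn f g₁ (Set.Ioo c a) := fun s hs => hf₁ s hs.1 hs.2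
  have e₂ : Set.EqOn f g₂ (Set.Ioi a) := fun s hs => hf₂ s (le_of_lt hs)
  rw [← Set.Ioc_union_Ioi_eq_Ioi hca,
    setIntegral_union (Set.Ioc_disjoint_Ioi le_rfl) measurableSet_Ioi
      ((integrableOn_Ioc_iff_integrableOn_Ioo).2 (hg₁.congr_fun e₁.symm measurableSet_Ioo))
      (hg₂.congr_fun e₂.symm measurableSet_Ioi),
    integral_Ioc_eq_integral_Ioo, setIntegral_congr_fun measurableSet_Ioo e₁,
    setIntegral_congr_fun measurableSet_Ioi e₂]

lemma integrableOn_Ioi_one_div_pow {c : ℝ} (hc : 0 < c) {n : ℕ} (hn : 1 < n) :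
    IntegrableOn (fun s : ℝ => 1 / s ^ n) (Set.Ioi c) := by
  have hn' : -(n : ℝ) < -1 := neg_lt_neg (by exact_mod_cast hn)
  refine (integrableOn_Ioi_rpow_of_lt hn' hc).congr_fun (fun s hs => ?_) measurableSet_Ioi
  simp [Real.rpow_neg (hc.trans hs).le]

lemma integral_Ioi_one_div_pow {c : ℝ} (hc : 0 < c) (n : ℕ) :
    ∫ s in Set.Ioi c, 1 / s ^ (n + 2) = 1 / ((n + 1) * c ^ (n + 1)) := by
  have hn : -((n + 2 : ℕ) : ℝ) < -1 := by
    push_cast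
    linarith [n.cast_nonneg (α := ℝ)]
  have e : Set.EqOn (fun s : ℝ => 1 / s ^ (n + 2)) (fun s => s ^ (-((n + 2 : ℕ) : ℝ)))
      (Set.Ioi c) := fun s hs => by
    dsimp only
    rw [Real.rpow_neg (hc.trans hs).le, Real.rpow_natCast, one_div]
  rw [setIntegral_congr_fun measurableSet_Ioi e, integral_Ioi_rpow_of_lt hn hc]
  have h₁ : -((n + 2 : ℕ) : ℝ) + 1 = -((n + 1 : ℕ) : ℝ) := by
    push_cast
    ring
  rw [h₁, Real.rpow_neg hc.le, Real.rpow_natCast]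
  push_cast
  field_simp

lemma integrableOn_Ioi_laurent {c : ℝ} (hc : 0 < c) (α β γ δ : ℝ) :
    IntegrableOn (fun s : ℝ => α * (1 / s ^ 2) + β * (1 / s ^ 3) + γ * (1 / s ^ 4) +
      δ * (1 / s ^ 5)) (Set.Ioi c) :=
  ((((integrableOn_Ioi_one_div_pow hc (by norm_num)).const_mul α).add
    ((integrableOn_Ioi_one_div_pow hc (by norm_num)).const_mul β)).add
    ((integrableOn_Ioi_one_div_pow hc (by norm_num)).const_mul γ)).add
    ((integrableOn_Ioi_one_div_pow hc (by norm_num)).const_mul δ)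

lemma integral_Ioi_laurent {c : ℝ} (hc : 0 < c) (α β γ δ : ℝ) :
    ∫ s in Set.Ioi c, (α * (1 / s ^ 2) + β * (1 / s ^ 3) + γ * (1 / s ^ 4) + δ * (1 / s ^ 5)) =
      α / c + β / (2 * c ^ 2) + γ / (3 * c ^ 3) + δ / (4 * c ^ 4) := by
  have i₂ := (integrableOn_Ioi_one_div_pow hc (n := 2) (by norm_num)).const_mul α
  have i₃ := (integrableOn_Ioi_one_div_pow hc (n := 3) (by norm_num)).const_mul β
  have i₄ := (integrableOn_Ioi_one_div_pow hc (n := 4) (by norm_num)).const_mul γ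
  have i₅ := (integrableOn_Ioi_one_div_pow hc (n := 5) (by norm_num)).const_mul δ
  have v₂ := integral_Ioi_one_div_pow hc 0
  have v₃ := integral_Ioi_one_div_pow hc 1
  have v₄ := integral_Ioi_one_div_pow hc 2
  have v₅ := integral_Ioi_one_div_pow hc 3
  norm_num only [Nat.reduceAdd] at v₂ v₃ v₄ v₅
  rw [integral_add (by exact (i₂.add i₃).add i₄) i₅, integral_add (by exact i₂.add i₃) i₄,
    integral_add i₂ i₃, integral_const_mul, integral_const_mul, integral_const_mul,
    integral_const_mul, v₂, v₃, v₄, v₅]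
  ring

lemma integral_Ioo_laurent {c a : ℝ} (hc : 0 < c) (hca : c ≤ a) (α β γ δ : ℝ) :
    ∫ s in Set.Ioo c a,
      (α * (1 / s ^ 2) + β * (1 / s ^ 3) + γ * (1 / s ^ 4) + δ * (1 / s ^ 5)) =
      (α / c + β / (2 * c ^ 2) + γ / (3 * c ^ 3) + δ / (4 * c ^ 4)) -
        (α / a + β / (2 * a ^ 2) + γ / (3 * a ^ 3) + δ / (4 * a ^ 4)) := by
  rw [← integral_Ioi_laurent hc, ← integral_Ioi_laurent (hc.trans_le hca),
    intervalIntegral.integral_Ioi_sub_Ioi (integrableOn_Ioi_laurent hc α β γ δ) hca,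
    intervalIntegral.integral_of_le hca, integral_Ioc_eq_integral_Ioo]

/-- A function that is one Laurent polynomial in `s` on `(c, a)` and another one on `[a, ∞)`. -/
lemma integral_Ioi_piecewise_laurent {f : ℝ → ℝ} {c a : ℝ} (hc : 0 < c) (hca : c ≤ a)
    (α β γ δ α' β' γ' δ' : ℝ)
    (hf₁ : ∀ s, c < s → s < a →
      f s = α * (1 / s ^ 2) + β * (1 / s ^ 3) + γ * (1 / s ^ 4) + δ * (1 / s ^ 5))
    (hf₂ : ∀ s, a ≤ s →
      f s = α' * (1 / s ^ 2) + β' * (1 / s ^ 3) + γ' * (1 / s ^ 4) + δ' * (1 / s ^ 5)) :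
    ∫ s in Set.Ioi c, f s =
      (α / c + β / (2 * c ^ 2) + γ / (3 * c ^ 3) + δ / (4 * c ^ 4)) -
        (α / a + β / (2 * a ^ 2) + γ / (3 * a ^ 3) + δ / (4 * a ^ 4)) +
        (α' / a + β' / (2 * a ^ 2) + γ' / (3 * a ^ 3) + δ' / (4 * a ^ 4)) := by
  have ha : 0 < a := hc.trans_le hca
  rw [setIntegral_Ioi_eq_add_of_piecewise hca hf₁ hf₂
      ((integrableOn_Ioi_laurent hc α β γ δ).mono_set Set.Ioo_subset_Ioi_self)
      (integrableOn_Ioi_laurent ha α' β' γ' δ'),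
    integral_Ioo_laurent hc hca, integral_Ioi_laurent ha]

theorem stmt_17
    (a : ℝ) (ha : 1 < a)
    (h : ℝ → ℝ)
    (hh1 : ∀ C, 0 < C → C < a → h C = 1 / a ^ 2)
    (hh2 : ∀ C, a ≤ C → h C = 1)
    (Q P : ℝ → ℝ)
    (hQ : ∀ C, Q C = C + ∫ s in Set.Ioi C, (1 - h s))
    (hP : ∀ C, P C = ∫ s in Set.Ioi C, h s / s ^ 2)
    (A B D X m q : ℝ)
    (hA : A = ∫ s in Set.Ioi (1:ℝ), Q s * h s / s ^ 4)
    (hB : B = ∫ s in Set.Ioi (1:ℝ), h s / s ^ 4)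
    (hD : D = ∫ s in Set.Ioi (1:ℝ), P s * h s / s ^ 4)
    (hX : X = P 1 * B - D)
    (hm : m = (P 1 * A - Q 1 * D) / (3 * X))
    (hq : q = Real.sqrt ((A - Q 1 * B) / (2 * X))) :
    q / m = 3 * a ^ ((5:ℝ)/2) *
        Real.sqrt ((a ^ 5 + 3 * a ^ 3 - 2 * a ^ 2 - 3 * a + 2) *
          (2 * a ^ 4 + 4 * a ^ 3 - 4 * a ^ 2 - 4 * a + 3)) /
      (4 * a ^ 7 + 6 * a ^ 6 - 2 * a ^ 5 - 4 * a ^ 4 - 5 * a ^ 3 + 2 * a ^ 2 + 3 * a - 1) := by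
  have ha0 : 0 < a := one_pos.trans ha
  have hane : a ≠ 0 := ha0.ne'
  have Q_lt : ∀ C, 0 < C → C < a → Q C = a - 1 / a + C / a ^ 2 := fun C hC hCa => by
    rw [hQ, setIntegral_Ioi_eq_add_of_piecewise (g₁ := fun _ => 1 - 1 / a ^ 2)
      (g₂ := fun _ => 0) hCa.le
      (fun s hs hsa => by rw [hh1 s (hC.trans hs) hsa]) (fun s hs => by rw [hh2 s hs, sub_self])
      (integrableOn_const (by simp)) integrableOn_zero, setIntegral_const, integral_zero,
      Real.volume_real_Ioo_of_le hCa.le, smul_eq_mul]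
    field_simp
    ring
  have Q_ge : ∀ C, a ≤ C → Q C = C := fun C hC => by
    rw [hQ, setIntegral_congr_fun (g := fun _ => 0) measurableSet_Ioi
      (fun s hs => by simp only [hh2 s (hC.trans (le_of_lt hs)), sub_self]), integral_zero,
      add_zero]
  have P_lt : ∀ C, 0 < C → C < a → P C = 1 / a - 1 / a ^ 3 + 1 / (a ^ 2 * C) :=
    fun C hC hCa => by
    rw [hP, integral_Ioi_piecewise_laurent hC hCa.le (1 / a ^ 2) 0 0 0 1 0 0 0
      (fun s hs hsa => by rw [hh1 s (hC.trans hs) hsa]; ring)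
      (fun s hs => by rw [hh2 s hs]; ring)]
    field_simp
    ring
  have P_ge : ∀ C, a ≤ C → P C = 1 / C := fun C hC => by
    rw [hP, integral_Ioi_piecewise_laurent (ha0.trans_le hC) le_rfl 1 0 0 0 1 0 0 0
      (fun s hs hsa => absurd hs hsa.not_gt)
      (fun s hs => by rw [hh2 s (hC.trans hs)]; ring)]
    ring
  have A_eq : A = (2 * a ^ 5 + 3 * a ^ 4 - 2 * a ^ 3 + a ^ 2 - 1) / (6 * a ^ 6) := by
    rw [hA, integral_Ioi_piecewise_laurent one_pos ha.le
      0 (1 / a ^ 4) ((a - 1 / a) / a ^ 2) 0 0 1 0 0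
      (fun s hs hsa => by
        have hs0 : 0 < s := one_pos.trans hs
        rw [Q_lt s hs0 hsa, hh1 s hs0 hsa]
        field_simp
        ring)
      (fun s hs => by
        have hs0 : 0 < s := ha0.trans_le hs
        rw [Q_ge s hs, hh2 s hs]
        field_simp
        ring)]
    field_simp
    ring
  have B_eq : B = (a ^ 3 + a ^ 2 - 1) / (3 * a ^ 5) := by
    rw [hB, integral_Ioi_piecewise_laurent one_pos ha.le 0 0 (1 / a ^ 2) 0 0 0 1 0
      (fun s hs hsa => by rw [hh1 s (one_pos.trans hs) hsa]; ring)
      (fun s hs => by rw [hh2 s hs]; ring)]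
    field_simp
    ring
  have D_eq : D = (4 * a ^ 5 + 6 * a ^ 4 - 4 * a ^ 3 - 4 * a ^ 2 + 1) / (12 * a ^ 8) := by
    rw [hD, integral_Ioi_piecewise_laurent one_pos ha.le
      0 0 ((1 / a - 1 / a ^ 3) / a ^ 2) (1 / a ^ 4) 0 0 0 1
      (fun s hs hsa => by
        have hs0 : 0 < s := one_pos.trans hs
        rw [P_lt s hs0 hsa, hh1 s hs0 hsa]
        field_simp
        ring)
      (fun s hs => by
        have hs0 : 0 < s := ha0.trans_le hs
        rw [P_ge s hs, hh2 s hs]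
        field_simp
        ring)]
    field_simp
    ring
  have Q_one := Q_lt 1 one_pos ha
  have P_one := P_lt 1 one_pos ha
  set F := a ^ 5 + 3 * a ^ 3 - 2 * a ^ 2 - 3 * a + 2 with hF
  set G := 2 * a ^ 4 + 4 * a ^ 3 - 4 * a ^ 2 - 4 * a + 3 with hG
  set H := 4 * a ^ 7 + 6 * a ^ 6 - 2 * a ^ 5 - 4 * a ^ 4 - 5 * a ^ 3 + 2 * a ^ 2 + 3 * a - 1
    with hH
  have G_pos : 0 < G := by
    have : G = 2 * (a ^ 2 - 1) ^ 2 + 4 * a * (a ^ 2 - 1) + 1 := by rw [hG]; ring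
    rw [this]
    have : 0 < a ^ 2 - 1 := by nlinarith
    positivity
  have X_eq : X = G / (12 * a ^ 8) := by
    rw [hX, P_one, B_eq, D_eq, hG]
    field_simp
    ring
  have m_eq : m = H / (3 * a ^ 2 * G) := by
    have : P 1 * A - Q 1 * D = H / (12 * a ^ 10) := by
      rw [P_one, Q_one, A_eq, D_eq, hH]
      field_simp
      ring
    rw [hm, this, X_eq]
    field_simp
  have q_eq : q = Real.sqrt a * Real.sqrt (F * G) / G := by
    have hN : A - Q 1 * B = F / (6 * a ^ 7) := by
      rw [Q_one, A_eq, B_eq, hF]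
      field_simp
      ring
    have : (A - Q 1 * B) / (2 * X) = a * (F * G) / G ^ 2 := by
      rw [hN, X_eq]
      field_simp
      ring
    rw [hq, this, Real.sqrt_div' _ (sq_nonneg G), Real.sqrt_sq G_pos.le,
      Real.sqrt_mul ha0.le]
  have a_rpow : a ^ ((5 : ℝ) / 2) = a ^ 2 * Real.sqrt a := by
    rw [Real.sqrt_eq_rpow, ← Real.rpow_natCast, ← Real.rpow_add ha0]
    norm_num
  rw [q_eq, m_eq, a_rpow, div_div_eq_mul_div]
  congr 1
  field_simp
end
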